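/- arXiv:math/0204310 — 4 statements merged into one kernel-verified Lean document; each statement's English description precedes it below -/
import Mathlib

section
/- Let L be a linear Dirac structure on V, P = π(L), and Ω_L the induced skew-symmetric bilinear form on P given by Ω_L(v₁,v₂) = ω₁(v₂) for (v₁,ω₁), (v₂,ω₂) ∈ L. Then L is exactly reconstructed from the pair (P, Ω_L): L = {(v,ω) ∈ V ⊕ V* : v ∈ P and ω(u) = Ω_L(v,u) for all u ∈ P}. -/
open Module

noncomputable section

/-- The canonical symmetric bilinear pairing on `V ⊕ V*`:
`⟨(v₁,ω₁),(v₂,ω₂)⟩ = (1/2)(ω₁(v₂) + ω₂(v₁))`. -/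
def diracPairing (V : Type*) [AddCommGroup V] [Module ℝ V]
    (x y : V × Module.Dual ℝ V) : ℝ :=
  (x.2 y.1 + y.2 x.1) / 2

/-- A linear Dirac structure on `V`: a subspace of `V ⊕ V*` which is isotropic for the
canonical symmetric pairing and has dimension `n = dim V` (i.e. is maximally isotropic). -/
def IsLinearDirac (V : Type*) [AddCommGroup V] [Module ℝ V]
    (L : Submodule ℝ (V × Module.Dual ℝ V)) : Prop :=
  (∀ x ∈ L, ∀ y ∈ L, diracPairing V x y = 0) ∧
  Module.finrank ℝ ↥L = Module.finrank ℝ V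

/-- Rank-nullity for the first projection restricted to a subspace of a product. -/
theorem Submodule.finrank_map_fst_add_finrank_comap_inr {K V W : Type*} [Field K]
    [AddCommGroup V] [Module K V] [AddCommGroup W] [Module K W]
    [FiniteDimensional K V] [FiniteDimensional K W] (L : Submodule K (V × W)) :
    finrank K (L.map (LinearMap.fst K V W)) + finrank K (L.comap (LinearMap.inr K V W)) =
      finrank K L := by
  have h := ((LinearMap.fst K V W).domRestrict L).finrank_range_add_finrank_ker
  rw [LinearMap.range_domRestrict] at h
  rw [← h]
  congr 1
  let e : L.comap (LinearMap.inr K V W) ≃ₗ[K]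
      LinearMap.ker ((LinearMap.fst K V W).domRestrict L) :=
    { toFun := fun w => ⟨⟨(0, w), w.2⟩, rfl⟩
      invFun := fun x => ⟨x.1.1.2, by
        have h : x.1.1.1 = 0 := x.2
        have h' : ((0 : V), x.1.1.2) = x.1.1 := Prod.ext h.symm rfl
        exact h' ▸ x.1.2⟩
      map_add' := fun x y => by ext <;> simp
      map_smul' := fun c x => by ext <;> simp
      left_inv := fun x => rfl
      right_inv := fun x => by
        have h : x.1.1.1 = 0 := x.2
        exact Subtype.ext (Subtype.ext (Prod.ext h.symm rfl)) }
  exact e.finrank_eq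

/-- Let `L ⊆ V ⊕ V*` be an isotropic subspace of dimension `dim V`. A covector annihilating the
projection of `L` to `V` lies in `L`. -/
theorem Submodule.mk_zero_mem_of_isotropic {K V : Type*} [Field K] [AddCommGroup V] [Module K V]
    [FiniteDimensional K V] {L : Submodule K (V × Module.Dual K V)}
    (hiso : ∀ x ∈ L, ∀ y ∈ L, x.2 y.1 + y.2 x.1 = 0) (hdim : finrank K L = finrank K V)
    {η : Module.Dual K V}
    (hη : η ∈ (L.map (LinearMap.fst K V (Module.Dual K V))).dualAnnihilator) :
    ((0 : V), η) ∈ L := by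
  have hle : L.comap (LinearMap.inr K V (Module.Dual K V)) ≤
      (L.map (LinearMap.fst K V (Module.Dual K V))).dualAnnihilator := by
    intro ξ hξ
    rw [Submodule.mem_dualAnnihilator]
    rintro _ ⟨y, hy, rfl⟩
    simpa using hiso _ hξ y hy
  have h₁ := Submodule.finrank_map_fst_add_finrank_comap_inr L
  have h₂ := Subspace.finrank_add_finrank_dualAnnihilator_eq
    (L.map (LinearMap.fst K V (Module.Dual K V)))
  have heq := Submodule.eq_of_le_of_finrank_eq hle (by omega)
  exact heq.ge hη

theorem statement1 (V : Type*) [AddCommGroup V] [Module ℝ V] [FiniteDimensional ℝ V]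
    (L : Submodule ℝ (V × Module.Dual ℝ V)) (hL : IsLinearDirac V L)
    (Ω : ↥(L.map (LinearMap.fst ℝ V (Module.Dual ℝ V))) →
      ↥(L.map (LinearMap.fst ℝ V (Module.Dual ℝ V))) → ℝ)
    (hΩ : ∀ x (hx : x ∈ L) y (hy : y ∈ L),
      Ω ⟨x.1, Submodule.mem_map_of_mem hx⟩ ⟨y.1, Submodule.mem_map_of_mem hy⟩ = x.2 y.1) :
    ∀ (v : V) (ω : Module.Dual ℝ V),
      (v, ω) ∈ L ↔ ∃ hv : v ∈ L.map (LinearMap.fst ℝ V (Module.Dual ℝ V)),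
        ∀ u (hu : u ∈ L.map (LinearMap.fst ℝ V (Module.Dual ℝ V))),
          ω u = Ω ⟨v, hv⟩ ⟨u, hu⟩ := by
  intro v ω
  constructor
  · intro h
    refine ⟨Submodule.mem_map_of_mem h, ?_⟩
    rintro _ ⟨y, hy, rfl⟩
    exact (hΩ _ h y hy).symm
  · rintro ⟨⟨⟨v, ω'⟩, hx, rfl⟩, h⟩
    have hη : ω - ω' ∈ (L.map (LinearMap.fst ℝ V (Module.Dual ℝ V))).dualAnnihilator := by
      rw [Submodule.mem_dualAnnihilator]
      rintro _ ⟨y, hy, rfl⟩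
      rw [LinearMap.sub_apply, sub_eq_zero]
      exact (h _ (Submodule.mem_map_of_mem hy)).trans (hΩ _ hx y hy)
    have hiso : ∀ x ∈ L, ∀ y ∈ L, x.2 y.1 + y.2 x.1 = 0 := fun x hx y hy => by
      simpa [diracPairing] using hL.1 x hx y hy
    simpa using L.add_mem hx (Submodule.mk_zero_mem_of_isotropic hiso hL.2 hη)
end
end

section
/- Let P be a subspace of V and Ω : P × P → ℝ a skew-symmetric bilinear form. Define L = {(v,ω) ∈ V ⊕ V* : v ∈ P and ω(u) = Ω(v,u) for all u ∈ P}. Then L is a subspace of V ⊕ V* which is isotropic with respect to the canonical symmetric bilinear form, and dim L = dim P + dim Ann(P) = n, where Ann(P) = {ω ∈ V* : ω(u) = 0 for all u ∈ P}. Hence L is a linear Dirac structure on V. -/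
open Module

noncomputable section

/-- The parametrization `(p, α) ↦ (p, s (Ω p) + α)` of the Dirac structure attached to `(P, Ω)`,
where `s` extends functionals from `P` to `V`. -/
def diracParam {V : Type*} [AddCommGroup V] [Module ℝ V] (P : Submodule ℝ V)
    (Ω : ↥P →ₗ[ℝ] ↥P →ₗ[ℝ] ℝ) (s : Module.Dual ℝ ↥P →ₗ[ℝ] Module.Dual ℝ V) :
    (↥P × ↥P.dualAnnihilator) →ₗ[ℝ] V × Module.Dual ℝ V :=
  (P.subtype ∘ₗ LinearMap.fst ℝ _ _).prod
    ((s ∘ₗ Ω).coprod P.dualAnnihilator.subtype)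

theorem diracParam_apply {V : Type*} [AddCommGroup V] [Module ℝ V] (P : Submodule ℝ V)
    (Ω : ↥P →ₗ[ℝ] ↥P →ₗ[ℝ] ℝ) (s : Module.Dual ℝ ↥P →ₗ[ℝ] Module.Dual ℝ V)
    (p : ↥P) (α : ↥P.dualAnnihilator) :
    diracParam P Ω s (p, α) = ((p : V), s (Ω p) + (α : Module.Dual ℝ V)) := rfl

theorem diracParam_injective {V : Type*} [AddCommGroup V] [Module ℝ V] (P : Submodule ℝ V)
    (Ω : ↥P →ₗ[ℝ] ↥P →ₗ[ℝ] ℝ) (s : Module.Dual ℝ ↥P →ₗ[ℝ] Module.Dual ℝ V) :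
    Function.Injective (diracParam P Ω s) := by
  rintro ⟨p, α⟩ ⟨q, β⟩ h
  rw [diracParam_apply, diracParam_apply, Prod.mk.injEq] at h
  obtain ⟨h₁, h₂⟩ := h
  obtain rfl : p = q := Subtype.ext h₁
  obtain rfl : α = β := Subtype.ext (add_left_cancel h₂)
  rfl

theorem mem_range_diracParam {V : Type*} [AddCommGroup V] [Module ℝ V] (P : Submodule ℝ V)
    (Ω : ↥P →ₗ[ℝ] ↥P →ₗ[ℝ] ℝ) (s : Module.Dual ℝ ↥P →ₗ[ℝ] Module.Dual ℝ V)
    (hs : ∀ (φ : Module.Dual ℝ ↥P) (u : ↥P), s φ u = φ u) (x : V × Module.Dual ℝ V) :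
    x ∈ LinearMap.range (diracParam P Ω s) ↔
      ∃ hv : x.1 ∈ P, ∀ u (hu : u ∈ P), x.2 u = Ω ⟨x.1, hv⟩ ⟨u, hu⟩ := by
  constructor
  · rintro ⟨⟨p, α⟩, rfl⟩
    refine ⟨p.2, fun u hu => ?_⟩
    have hα : (α : Module.Dual ℝ V) u = 0 := (Submodule.mem_dualAnnihilator _).1 α.2 u hu
    have hp : s (Ω p) u = Ω p ⟨u, hu⟩ := hs (Ω p) ⟨u, hu⟩
    simp [diracParam_apply, hα, hp]
  · rintro ⟨hv, h⟩
    refine ⟨(⟨x.1, hv⟩, ⟨x.2 - s (Ω ⟨x.1, hv⟩), ?_⟩), ?_⟩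
    · rw [Submodule.mem_dualAnnihilator]
      intro u hu
      rw [LinearMap.sub_apply, h u hu, sub_eq_zero]
      exact (hs _ ⟨u, hu⟩).symm
    · rw [diracParam_apply]
      exact Prod.ext rfl (add_sub_cancel _ _)

theorem statement2 (V : Type*) [AddCommGroup V] [Module ℝ V] [FiniteDimensional ℝ V]
    (P : Submodule ℝ V) (Ω : ↥P →ₗ[ℝ] ↥P →ₗ[ℝ] ℝ)
    (hskew : ∀ a b, Ω a b = - Ω b a) :
    ∃ L : Submodule ℝ (V × Module.Dual ℝ V),
      ((L : Set (V × Module.Dual ℝ V)) =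
        {x | ∃ hv : x.1 ∈ P, ∀ u (hu : u ∈ P), x.2 u = Ω ⟨x.1, hv⟩ ⟨u, hu⟩}) ∧
      (∀ x ∈ L, ∀ y ∈ L, diracPairing V x y = 0) ∧
      Module.finrank ℝ ↥L = Module.finrank ℝ ↥P + Module.finrank ℝ ↥P.dualAnnihilator ∧
      Module.finrank ℝ ↥L = Module.finrank ℝ V := by
  obtain ⟨s, hs⟩ := P.dualRestrict.exists_rightInverse_of_surjective
    (LinearMap.range_eq_top.2 Subspace.dualRestrict_surjective)
  have hs' : ∀ (φ : Module.Dual ℝ ↥P) (u : ↥P), s φ u = φ u := fun φ u =>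
    LinearMap.congr_fun (LinearMap.congr_fun hs φ) u
  have hmem := mem_range_diracParam P Ω s hs'
  have hdim : Module.finrank ℝ ↥(LinearMap.range (diracParam P Ω s)) =
      Module.finrank ℝ ↥P + Module.finrank ℝ ↥P.dualAnnihilator := by
    have : Module.Free ℝ ↥P.dualAnnihilator :=
      @Module.Free.of_divisionRing ℝ ↥P.dualAnnihilator _ (Submodule.addCommGroup _) _
    rw [LinearMap.finrank_range_of_inj (diracParam_injective P Ω s), Module.finrank_prod]
  refine ⟨LinearMap.range (diracParam P Ω s), Set.ext hmem, fun x hx y hy => ?_, hdim, ?_⟩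
  · obtain ⟨hx₁, hx₂⟩ := (hmem x).1 hx
    obtain ⟨hy₁, hy₂⟩ := (hmem y).1 hy
    rw [diracPairing, hx₂ _ hy₁, hy₂ _ hx₁, hskew, neg_add_cancel, zero_div]
  · rw [hdim, Subspace.finrank_add_finrank_dualAnnihilator_eq]
end
end

section
/- There is a bijective correspondence between linear Dirac structures on V and pairs (P, Ω) consisting of a subspace P ⊆ V and a skew-symmetric bilinear form Ω : P × P → ℝ. Explicitly, the map sending a linear Dirac structure L to the pair (π(L), Ω_L), where Ω_L(v₁,v₂) = ω₁(v₂) for (v₁,ω₁), (v₂,ω₂) ∈ L, and the map sending a pair (P, Ω) to L(P,Ω) = {(v,ω) ∈ V ⊕ V* : v ∈ P and ω(u) = Ω(v,u) for all u ∈ P}, are mutually inverse bijections. -/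
open Module

noncomputable section

/-- A pair `(P, Ω)` of a subspace `P ⊆ V` and a skew-symmetric bilinear form on `P`. -/
structure SubspaceWithSkewForm (V : Type*) [AddCommGroup V] [Module ℝ V] where
  P : Submodule ℝ V
  form : ↥P →ₗ[ℝ] ↥P →ₗ[ℝ] ℝ
  skew : ∀ a b, form a b = - form b a

namespace SubspaceWithSkewForm

variable {V : Type*} [AddCommGroup V] [Module ℝ V]

theorem ext_of_apply {p q : SubspaceWithSkewForm V} (hP : p.P = q.P)
    (h : ∀ a b (ha : a ∈ p.P) (hb : b ∈ p.P) (ha' : a ∈ q.P) (hb' : b ∈ q.P),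
      p.form ⟨a, ha⟩ ⟨b, hb⟩ = q.form ⟨a, ha'⟩ ⟨b, hb'⟩) : p = q := by
  obtain ⟨P, f, hf⟩ := p
  obtain ⟨Q, g, hg⟩ := q
  obtain rfl : P = Q := hP
  obtain rfl : f = g := by
    ext ⟨a, ha⟩ ⟨b, hb⟩
    exact h a b ha hb ha hb
  rfl

/-- The map `(v, ω) ↦ ω|_P - Ω(v, ·)`, whose kernel is the Dirac structure of `(P, Ω)`. -/
def defect (p : SubspaceWithSkewForm V) : (p.P × Dual ℝ V) →ₗ[ℝ] Dual ℝ p.P :=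
  p.P.dualRestrict ∘ₗ LinearMap.snd ℝ _ _ - p.form ∘ₗ LinearMap.fst ℝ _ _

theorem defect_surjective (p : SubspaceWithSkewForm V) : Function.Surjective p.defect := by
  intro f
  obtain ⟨ω, rfl⟩ := Subspace.dualRestrict_surjective (W := p.P) f
  exact ⟨(0, ω), by simp [defect]⟩

/-- The subspace `{(v, ω) | v ∈ P, ω|_P = Ω(v, ·)}` of `V ⊕ V*`. -/
def diracSubmodule (p : SubspaceWithSkewForm V) : Submodule ℝ (V × Dual ℝ V) :=
  (LinearMap.ker p.defect).map (p.P.subtype.prodMap LinearMap.id)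

theorem mem_diracSubmodule {p : SubspaceWithSkewForm V} {x : V × Dual ℝ V} :
    x ∈ p.diracSubmodule ↔
      ∃ hv : x.1 ∈ p.P, ∀ u (hu : u ∈ p.P), x.2 u = p.form ⟨x.1, hv⟩ ⟨u, hu⟩ := by
  constructor
  · rintro ⟨⟨v, ω⟩, hy, rfl⟩
    refine ⟨v.2, fun u hu => ?_⟩
    have := LinearMap.congr_fun (LinearMap.mem_ker.mp hy) ⟨u, hu⟩
    simpa [defect, sub_eq_zero] using this
  · rintro ⟨hv, h⟩
    refine ⟨(⟨x.1, hv⟩, x.2), LinearMap.mem_ker.mpr ?_, rfl⟩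
    ext ⟨u, hu⟩
    simpa [defect, sub_eq_zero] using h u hu

theorem isLinearDirac_diracSubmodule [FiniteDimensional ℝ V] (p : SubspaceWithSkewForm V) :
    IsLinearDirac V p.diracSubmodule := by
  constructor
  · intro x hx y hy
    obtain ⟨hx₁, hx⟩ := mem_diracSubmodule.mp hx
    obtain ⟨hy₁, hy⟩ := mem_diracSubmodule.mp hy
    simp [diracPairing, hx _ hy₁, hy _ hx₁, p.skew ⟨x.1, hx₁⟩ ⟨y.1, hy₁⟩]
  · have hinj : Function.Injective (p.P.subtype.prodMap (LinearMap.id : Dual ℝ V →ₗ[ℝ] _)) :=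
      Function.Injective.prodMap p.P.injective_subtype Function.injective_id
    have h := p.defect.finrank_range_add_finrank_ker
    rw [LinearMap.range_eq_top.mpr p.defect_surjective, finrank_top, finrank_prod,
      Subspace.dual_finrank_eq, Subspace.dual_finrank_eq] at h
    rw [diracSubmodule, ← (Submodule.equivMapOfInjective _ hinj _).finrank_eq]
    omega

theorem map_fst_diracSubmodule (p : SubspaceWithSkewForm V) :
    p.diracSubmodule.map (LinearMap.fst ℝ V (Dual ℝ V)) = p.P := by
  ext v
  constructor
  · rintro ⟨x, hx, rfl⟩
    exact (mem_diracSubmodule.mp hx).1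
  · intro hv
    obtain ⟨ω, hω⟩ := Subspace.dualRestrict_surjective (W := p.P) (p.form ⟨v, hv⟩)
    exact ⟨(v, ω), mem_diracSubmodule.mpr ⟨hv, fun u hu => LinearMap.congr_fun hω ⟨u, hu⟩⟩, rfl⟩

end SubspaceWithSkewForm

namespace IsLinearDirac

variable {V : Type*} [AddCommGroup V] [Module ℝ V] {L : Submodule ℝ (V × Dual ℝ V)}

theorem apply_eq_neg (hL : IsLinearDirac V L) {x y : V × Dual ℝ V} (hx : x ∈ L) (hy : y ∈ L) :
    x.2 y.1 = - y.2 x.1 := by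
  have := hL.1 x hx y hy
  unfold diracPairing at this
  linarith

theorem exists_skewForm (hL : IsLinearDirac V L) :
    ∃ p : SubspaceWithSkewForm V, p.P = L.map (LinearMap.fst ℝ V (Dual ℝ V)) ∧
      ∀ x ∈ L, ∀ y ∈ L, ∀ (hx : x.1 ∈ p.P) (hy : y.1 ∈ p.P),
        p.form ⟨x.1, hx⟩ ⟨y.1, hy⟩ = x.2 y.1 := by
  let fst := LinearMap.fst ℝ V (Dual ℝ V)
  obtain ⟨s, hs⟩ := (fst.submoduleMap L).exists_rightInverse_of_surjective
    (LinearMap.range_eq_top.mpr (fst.submoduleMap_surjective L))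
  have hs₁ (a : L.map fst) : (s a : V × Dual ℝ V).1 = a :=
    congrArg Subtype.val (LinearMap.congr_fun hs a)
  let form : L.map fst →ₗ[ℝ] L.map fst →ₗ[ℝ] ℝ :=
    (L.map fst).dualRestrict ∘ₗ LinearMap.snd ℝ V (Dual ℝ V) ∘ₗ L.subtype ∘ₗ s
  have hform (a b : L.map fst) : form a b = (s a : V × Dual ℝ V).2 b := rfl
  refine ⟨⟨L.map fst, form, fun a b => ?_⟩, rfl, fun x hx y hy hx₁ hy₁ => ?_⟩
  · rw [hform, hform, ← hs₁ b, hL.apply_eq_neg (s a).2 (s b).2, hs₁ a]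
  · rw [hform, hL.apply_eq_neg (s _).2 hy, hs₁, hL.apply_eq_neg hx hy]

/-- The pair `(π(L), Ω_L)` of a linear Dirac structure `L`. -/
def skewForm (hL : IsLinearDirac V L) : SubspaceWithSkewForm V :=
  hL.exists_skewForm.choose

theorem skewForm_P (hL : IsLinearDirac V L) :
    hL.skewForm.P = L.map (LinearMap.fst ℝ V (Dual ℝ V)) :=
  hL.exists_skewForm.choose_spec.1

theorem skewForm_form (hL : IsLinearDirac V L) :
    ∀ x ∈ L, ∀ y ∈ L, ∀ (hx : x.1 ∈ hL.skewForm.P) (hy : y.1 ∈ hL.skewForm.P),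
      hL.skewForm.form ⟨x.1, hx⟩ ⟨y.1, hy⟩ = x.2 y.1 :=
  hL.exists_skewForm.choose_spec.2

theorem diracSubmodule_skewForm [FiniteDimensional ℝ V] (hL : IsLinearDirac V L) :
    hL.skewForm.diracSubmodule = L := by
  refine (Submodule.eq_of_le_of_finrank_eq (fun x hx => ?_) ?_).symm
  · have hx₁ : x.1 ∈ hL.skewForm.P := hL.skewForm_P ▸ ⟨x, hx, rfl⟩
    refine SubspaceWithSkewForm.mem_diracSubmodule.mpr ⟨hx₁, fun u hu => ?_⟩
    obtain ⟨y, hy, rfl⟩ := hL.skewForm_P ▸ hu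
    exact (hL.skewForm_form x hx y hy hx₁ hu).symm
  · rw [hL.2, hL.skewForm.isLinearDirac_diracSubmodule.2]

end IsLinearDirac

theorem SubspaceWithSkewForm.skewForm_diracSubmodule {V : Type*} [AddCommGroup V] [Module ℝ V]
    [FiniteDimensional ℝ V] (p : SubspaceWithSkewForm V) :
    p.isLinearDirac_diracSubmodule.skewForm = p := by
  have hL := p.isLinearDirac_diracSubmodule
  refine ext_of_apply (hL.skewForm_P.trans p.map_fst_diracSubmodule) fun a b ha hb ha' hb' => ?_
  obtain ⟨x, hx, rfl⟩ := p.map_fst_diracSubmodule.symm ▸ ha'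
  obtain ⟨y, hy, rfl⟩ := p.map_fst_diracSubmodule.symm ▸ hb'
  exact (hL.skewForm_form x hx y hy ha hb).trans ((mem_diracSubmodule.mp hx).2 _ hb')

theorem statement3 (V : Type*) [AddCommGroup V] [Module ℝ V] [FiniteDimensional ℝ V] :
    ∃ (F : {L : Submodule ℝ (V × Module.Dual ℝ V) // IsLinearDirac V L} →
        SubspaceWithSkewForm V)
      (G : SubspaceWithSkewForm V →
        {L : Submodule ℝ (V × Module.Dual ℝ V) // IsLinearDirac V L}),
      Function.LeftInverse G F ∧ Function.RightInverse G F ∧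
      (∀ L, (F L).P = (L : Submodule ℝ (V × Module.Dual ℝ V)).map
          (LinearMap.fst ℝ V (Module.Dual ℝ V)) ∧
        ∀ x ∈ (L : Submodule ℝ (V × Module.Dual ℝ V)),
          ∀ y ∈ (L : Submodule ℝ (V × Module.Dual ℝ V)),
            ∀ (hx : x.1 ∈ (F L).P) (hy : y.1 ∈ (F L).P),
              (F L).form ⟨x.1, hx⟩ ⟨y.1, hy⟩ = x.2 y.1) ∧
      (∀ pr : SubspaceWithSkewForm V,
        ((G pr : Submodule ℝ (V × Module.Dual ℝ V)) : Set (V × Module.Dual ℝ V)) =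
          {x | ∃ hv : x.1 ∈ pr.P, ∀ u (hu : u ∈ pr.P), x.2 u = pr.form ⟨x.1, hv⟩ ⟨u, hu⟩}) := by
  exact ⟨fun L => L.2.skewForm, fun p => ⟨p.diracSubmodule, p.isLinearDirac_diracSubmodule⟩,
    fun L => Subtype.ext L.2.diracSubmodule_skewForm,
    fun p => p.skewForm_diracSubmodule,
    fun L => ⟨L.2.skewForm_P, L.2.skewForm_form⟩,
    fun p => Set.ext fun x => SubspaceWithSkewForm.mem_diracSubmodule⟩
end
end

section
/- Let S be a subspace of V* and Π : S × S → ℝ a skew-symmetric bilinear form. Define L = {(v,ω) ∈ V ⊕ V* : ω ∈ S and η(v) = Π(ω,η) for all η ∈ S}. Then L is a subspace of V ⊕ V* which is isotropic with respect to the canonical symmetric bilinear form and has dim L = n; hence L is a linear Dirac structure on V. -/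
open Module

noncomputable section

/-- The linear map `(v, ω) ↦ (η ↦ η v - Π(ω, η))`, whose kernel is the graph of `Π`. -/
def bivectorDefect {V : Type*} [AddCommGroup V] [Module ℝ V]
    (S : Submodule ℝ (Module.Dual ℝ V)) (Pi : ↥S →ₗ[ℝ] ↥S →ₗ[ℝ] ℝ) :
    V × ↥S →ₗ[ℝ] Module.Dual ℝ ↥S :=
  (S.dualRestrict ∘ₗ Module.Dual.eval ℝ V).coprod (-Pi)

lemma bivectorDefect_apply {V : Type*} [AddCommGroup V] [Module ℝ V]
    (S : Submodule ℝ (Module.Dual ℝ V)) (Pi : ↥S →ₗ[ℝ] ↥S →ₗ[ℝ] ℝ) (x : V × ↥S) (η : ↥S) :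
    bivectorDefect S Pi x η = (η : Module.Dual ℝ V) x.1 - Pi x.2 η := by
  simp [bivectorDefect, sub_eq_add_neg]

lemma bivectorDefect_surjective {V : Type*} [AddCommGroup V] [Module ℝ V]
    [FiniteDimensional ℝ V] (S : Submodule ℝ (Module.Dual ℝ V))
    (Pi : ↥S →ₗ[ℝ] ↥S →ₗ[ℝ] ℝ) : Function.Surjective (bivectorDefect S Pi) := by
  intro f
  obtain ⟨g, rfl⟩ := Subspace.dualRestrict_surjective f
  obtain ⟨v, rfl⟩ := (Module.evalEquiv ℝ V).surjective g
  exact ⟨(v, 0), by simp [bivectorDefect]⟩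

lemma finrank_ker_bivectorDefect {V : Type*} [AddCommGroup V] [Module ℝ V]
    [FiniteDimensional ℝ V] (S : Submodule ℝ (Module.Dual ℝ V))
    (Pi : ↥S →ₗ[ℝ] ↥S →ₗ[ℝ] ℝ) :
    Module.finrank ℝ (LinearMap.ker (bivectorDefect S Pi)) = Module.finrank ℝ V := by
  have : Module.Free ℝ ↥S := Module.Free.of_divisionRing ℝ ↥S
  have hdual : Module.finrank ℝ (Module.Dual ℝ ↥S) = Module.finrank ℝ ↥S :=
    Subspace.dual_finrank_eq (K := ℝ) (V := ↥S)
  have h := LinearMap.finrank_range_add_finrank_ker (K := ℝ) (V := V × ↥S)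
    (V₂ := Module.Dual ℝ ↥S) (bivectorDefect S Pi)
  rw [LinearMap.range_eq_top.mpr (bivectorDefect_surjective S Pi), finrank_top,
    hdual, Module.finrank_prod] at h
  omega

theorem statement5 (V : Type*) [AddCommGroup V] [Module ℝ V] [FiniteDimensional ℝ V]
    (S : Submodule ℝ (Module.Dual ℝ V)) (Pi : ↥S →ₗ[ℝ] ↥S →ₗ[ℝ] ℝ)
    (hskew : ∀ a b, Pi a b = - Pi b a) :
    ∃ L : Submodule ℝ (V × Module.Dual ℝ V),
      ((L : Set (V × Module.Dual ℝ V)) =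
        {x | ∃ hω : x.2 ∈ S, ∀ η (hη : η ∈ S), η x.1 = Pi ⟨x.2, hω⟩ ⟨η, hη⟩}) ∧
      (∀ x ∈ L, ∀ y ∈ L, diracPairing V x y = 0) ∧
      Module.finrank ℝ ↥L = Module.finrank ℝ V := by
  have hinj : Function.Injective (LinearMap.prodMap (LinearMap.id : V →ₗ[ℝ] V) S.subtype) :=
    Function.injective_id.prodMap S.subtype_injective
  have hmem : ∀ x : V × Module.Dual ℝ V,
      x ∈ (LinearMap.ker (bivectorDefect S Pi)).map (LinearMap.prodMap LinearMap.id S.subtype) ↔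
        ∃ hω : x.2 ∈ S, ∀ η (hη : η ∈ S), η x.1 = Pi ⟨x.2, hω⟩ ⟨η, hη⟩ := by
    intro x
    constructor
    · rintro ⟨⟨v, ω⟩, hker, rfl⟩
      refine ⟨ω.2, fun η hη => ?_⟩
      have h := LinearMap.congr_fun (LinearMap.mem_ker.mp hker) ⟨η, hη⟩
      rw [bivectorDefect_apply] at h
      exact sub_eq_zero.mp h
    · rintro ⟨hω, h⟩
      refine ⟨(x.1, ⟨x.2, hω⟩), LinearMap.mem_ker.mpr (LinearMap.ext fun η => ?_), rfl⟩
      rw [bivectorDefect_apply]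
      exact sub_eq_zero.mpr (h η η.2)
  refine ⟨_, Set.ext hmem, fun x hx y hy => ?_, ?_⟩
  · obtain ⟨hxS, hx⟩ := (hmem x).mp hx
    obtain ⟨hyS, hy⟩ := (hmem y).mp hy
    rw [diracPairing, hy x.2 hxS, hx y.2 hyS, hskew, neg_add_cancel, zero_div]
  · rw [← finrank_ker_bivectorDefect S Pi]
    exact (Submodule.equivMapOfInjective _ hinj _).finrank_eq.symm
end
end
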